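/- Combining the three cases: for every arm i ≠ i⋆ and epoch m, the per-epoch regret contribution R_i^m = Δ_i n_i^m satisfies R_i^m ≤ 32²λ/Δ_i + 8λρ_{m-1}·2^{2m}, given that n_i^m = λ(Δ_i^{m-1})^{-2}, 2^{-(m-1)} ≤ Δ_i^{m-1} ≤ 1, and Δ_i^{m-1} ≥ Δ_i/2 − 3ρ_{m-1} − (3/4)·2^{-(m-1)}. -/

import Mathlib

/-- Combining the three cases: the per-epoch regret contribution of an arm with
gap `Δ` satisfies `Δ·n ≤ 32²λ/Δ + 8λρ·2^{2m}`. -/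
theorem stmt7 (m : ℕ) (hm : 1 ≤ m) (Δ Δ' lam ρ n : ℝ)
    (hΔ : 0 < Δ) (hΔ1 : Δ ≤ 1) (hlam : 0 < lam) (hρ : 0 ≤ ρ)
    (hΔ'lb : ((1/2:ℝ))^(m-1) ≤ Δ') (hΔ'ub : Δ' ≤ 1)
    (hΔ'est : Δ/2 - 3*ρ - (3/4) * ((1/2:ℝ))^(m-1) ≤ Δ')
    (hn : n = lam / Δ'^2) :
    Δ * n ≤ 32^2 * lam / Δ + 8 * lam * ρ * 2^(2*m) := by
  obtain ⟨k, rfl⟩ : ∃ k, m = k + 1 := ⟨m - 1, by omega⟩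
  simp only [Nat.add_sub_cancel] at hΔ'lb hΔ'est
  have hpow : (2:ℝ)^(2*(k+1)) = 4 / ((1/2:ℝ)^k)^2 := by
    rw [one_div, inv_pow, inv_pow, div_inv_eq_mul]
    ring
  have he : (0:ℝ) < (1/2:ℝ)^k := by positivity
  rw [hpow, hn]
  generalize (1/2:ℝ)^k = e at *
  have hΔ' : 0 < Δ' := he.trans_le hΔ'lb
  rcases le_total Δ (32 * Δ') with h | h
  · have hmain : Δ * (lam / Δ'^2) ≤ 32^2 * lam / Δ := by
      rw [← mul_div_assoc, div_le_div_iff₀ (by positivity) hΔ]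
      have hsq : Δ^2 ≤ (32 * Δ')^2 := by gcongr
      nlinarith [mul_le_mul_of_nonneg_left hsq hlam.le]
    have hnonneg : 0 ≤ 8 * lam * ρ * (4 / e^2) := by positivity
    linarith
  · have hρΔ : Δ ≤ 32 * ρ := by linarith
    have hmain : Δ * (lam / Δ'^2) ≤ (32 * ρ) * (lam / e^2) := by gcongr
    have heq : 8 * lam * ρ * (4 / e^2) = (32 * ρ) * (lam / e^2) := by ring
    have hnonneg : 0 ≤ 32^2 * lam / Δ := by positivity
    linarith
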